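/- arXiv:2410.04854 — 5 statements merged into one kernel-verified Lean document; each statement's English description precedes it below -/
import Mathlib

section
/- Let ω0, H, D, R, Td0', Tq0', Xd, Xd', Xq, Xq' be real numbers with H > 0, Td0' > 0, Tq0' > 0 and y2 > 0, and set a0 := D·ω0/(2H), a1 := 1/Td0', a2 := 1/Tq0', b0 := ω0/(2H), b1 := (Xd − Xd')/Td0', b2 := (Xq − Xq')/Tq0', b3 := ω0·R/(2H). Let x1, x2, x3, x4, u1, u2, y1, y5, y6, Iq, Id ∈ ℝ and set α := x1 − y1, Vq := y2·cos α, Vd := y2·sin α. Assume Vq = x3 − R·Iq − Xd'·Id, Vd = x4 + Xq'·Iq − R·Id, y5 = Vq·Iq + Vd·Id and y6 = Vq·Id − Vd·Iq, and define Pe := x3·Iq + x4·Id + (Xq' − Xd')·Id·Iq and y4² := Iq² + Id². Then the following three identities hold: (i) (ω0/(2H))·(u1 − Pe − D·x2) = −a0·x2 + b0·(u1 − y5) − b3·y4²; (ii) (1/Td0')·(u2 − x3 − (Xd − Xd')·Id) = −a1·x3 − (b1/y2)·(sin α·y5 + cos α·y6) + a1·u2; (iii) (1/Tq0')·(−x4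 + (Xq − Xq')·Iq) = −a2·x4 + (b2/y2)·(cos α·y5 − sin α·y6). -/
theorem stmt_7 (ω0 H D R Td0' Tq0' Xd Xd' Xq Xq' y2 : ℝ)
    (hH : 0 < H) (hTd : 0 < Td0') (hTq : 0 < Tq0') (hy2 : 0 < y2)
    (a0 a1 a2 b0 b1 b2 b3 : ℝ)
    (ha0 : a0 = D * ω0 / (2 * H)) (ha1 : a1 = 1 / Td0') (ha2 : a2 = 1 / Tq0')
    (hb0 : b0 = ω0 / (2 * H)) (hb1 : b1 = (Xd - Xd') / Td0')
    (hb2 : b2 = (Xq - Xq') / Tq0') (hb3 : b3 = ω0 * R / (2 * H))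
    (x1 x2 x3 x4 u1 u2 y1 y5 y6 Iq Id : ℝ)
    (α Vq Vd : ℝ) (hα : α = x1 - y1)
    (hVq : Vq = y2 * Real.cos α) (hVd : Vd = y2 * Real.sin α)
    (hsq : Vq = x3 - R * Iq - Xd' * Id)
    (hsd : Vd = x4 + Xq' * Iq - R * Id)
    (hy5 : y5 = Vq * Iq + Vd * Id)
    (hy6 : y6 = Vq * Id - Vd * Iq)
    (Pe y4sq : ℝ)
    (hPe : Pe = x3 * Iq + x4 * Id + (Xq' - Xd') * Id * Iq)
    (hy4 : y4sq = Iq ^ 2 + Id ^ 2) :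
    (ω0 / (2 * H)) * (u1 - Pe - D * x2) = -a0 * x2 + b0 * (u1 - y5) - b3 * y4sq ∧
    (1 / Td0') * (u2 - x3 - (Xd - Xd') * Id) =
      -a1 * x3 - (b1 / y2) * (Real.sin α * y5 + Real.cos α * y6) + a1 * u2 ∧
    (1 / Tq0') * (-x4 + (Xq - Xq') * Iq) =
      -a2 * x4 + (b2 / y2) * (Real.cos α * y5 - Real.sin α * y6) := by
  have h_trig := Real.sin_sq_add_cos_sq α
  have hP : Pe = y5 + R * y4sq := by
    rw [hPe, hy5, hy4]
    linear_combination -Iq * hsq - Id * hsd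
  have hId : Real.sin α * y5 + Real.cos α * y6 = y2 * Id := by
    rw [hy5, hy6, hVq, hVd]
    linear_combination y2 * Id * h_trig
  have hIq : Real.cos α * y5 - Real.sin α * y6 = y2 * Iq := by
    rw [hy5, hy6, hVq, hVd]
    linear_combination y2 * Iq * h_trig
  refine ⟨?_, ?_, ?_⟩
  · rw [hP, ha0, hb0, hb3]
    ring
  · rw [hId, ha1, hb1, ← mul_assoc, div_mul_cancel₀ _ hy2.ne']
    ring
  · rw [hIq, ha2, hb2, ← mul_assoc, div_mul_cancel₀ _ hy2.ne']
    ring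
end

section
/- Let y1, y5, y6, v1, θ0 ∈ ℝ, y2 ≠ 0, Xd' ≠ 0, Xq' ≠ 0. Define cv := cos(v1 − y1), sv := sin(v1 − y1), a1 := Xd'·y5·cv − (Xd'·y6 + y2²)·sv, a2 := Xd'·y5·sv + (Xd'·y6 + y2²)·cv, a3 := (Xq'·y6 + y2²)·cv + Xq'·y5·sv, a4 := (Xq'·y6 + y2²)·sv − Xq'·y5·cv, and ψ2,1 := (1/Xd'²)·(a1²/y2² + sv²·y2² + 2·a1·sv) + (1/Xq'²)·(a3²/y2² + cv²·y2² − 2·a3·cv), ψ2,2 := (1/Xd'²)·(a2²/y2² + cv²·y2² − 2·a2·cv) + (1/Xq'²)·(a4²/y2² + sv²·y2² − 2·a4·sv), ψ2,3 := 2·[(1/Xd'²)·(−a1·cv + a2·sv + a1·a2/y2² − cv·sv·y2²) + (1/Xq'²)·(−a4·cv − a3·sv + a3·a4/y2² + cv·sv·y2²)]. Set θ1 := sin θ0, θ2 := cos θ0, α := v1 + θ0 − y1, x3 := (a1·θ1 + a2·θ2)/y2, x4 := (a3·θ1 + a4·θ2)/y2, Id := (x3 − y2·cos α)/Xd' and Iq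 := −(x4 − y2·sin α)/Xq'. Then Iq² + Id² = ψ2,1·θ1² + ψ2,2·θ2² + ψ2,3·θ1·θ2. -/
theorem stmt_10 (y1 y2 y5 y6 v1 θ0 Xd' Xq' : ℝ)
    (hy2 : y2 ≠ 0) (hXd : Xd' ≠ 0) (hXq : Xq' ≠ 0)
    (cv sv a1 a2 a3 a4 ψ21 ψ22 ψ23 : ℝ)
    (hcv : cv = Real.cos (v1 - y1)) (hsv : sv = Real.sin (v1 - y1))
    (ha1 : a1 = Xd' * y5 * cv - (Xd' * y6 + y2 ^ 2) * sv)
    (ha2 : a2 = Xd' * y5 * sv + (Xd' * y6 + y2 ^ 2) * cv)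
    (ha3 : a3 = (Xq' * y6 + y2 ^ 2) * cv + Xq' * y5 * sv)
    (ha4 : a4 = (Xq' * y6 + y2 ^ 2) * sv - Xq' * y5 * cv)
    (hψ21 : ψ21 = (1 / Xd' ^ 2) * (a1 ^ 2 / y2 ^ 2 + sv ^ 2 * y2 ^ 2 + 2 * a1 * sv) +
      (1 / Xq' ^ 2) * (a3 ^ 2 / y2 ^ 2 + cv ^ 2 * y2 ^ 2 - 2 * a3 * cv))
    (hψ22 : ψ22 = (1 / Xd' ^ 2) * (a2 ^ 2 / y2 ^ 2 + cv ^ 2 * y2 ^ 2 - 2 * a2 * cv) +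
      (1 / Xq' ^ 2) * (a4 ^ 2 / y2 ^ 2 + sv ^ 2 * y2 ^ 2 - 2 * a4 * sv))
    (hψ23 : ψ23 = 2 * ((1 / Xd' ^ 2) * (-a1 * cv + a2 * sv + a1 * a2 / y2 ^ 2 - cv * sv * y2 ^ 2) +
      (1 / Xq' ^ 2) * (-a4 * cv - a3 * sv + a3 * a4 / y2 ^ 2 + cv * sv * y2 ^ 2)))
    (θ1 θ2 α x3 x4 Id Iq : ℝ)
    (hθ1 : θ1 = Real.sin θ0) (hθ2 : θ2 = Real.cos θ0)
    (hα : α = v1 + θ0 - y1)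
    (hx3 : x3 = (a1 * θ1 + a2 * θ2) / y2)
    (hx4 : x4 = (a3 * θ1 + a4 * θ2) / y2)
    (hId : Id = (x3 - y2 * Real.cos α) / Xd')
    (hIq : Iq = -(x4 - y2 * Real.sin α) / Xq') :
    Iq ^ 2 + Id ^ 2 = ψ21 * θ1 ^ 2 + ψ22 * θ2 ^ 2 + ψ23 * (θ1 * θ2) := by
  have hcos : Real.cos α = cv * θ2 - sv * θ1 := by
    rw [hα, hcv, hsv, hθ1, hθ2, ← Real.cos_add]
    ring_nf
  have hsin : Real.sin α = sv * θ2 + cv * θ1 := by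
    rw [hα, hcv, hsv, hθ1, hθ2, ← Real.sin_add]
    ring_nf
  rw [hIq, hId, hx3, hx4, hcos, hsin, hψ21, hψ22, hψ23]
  field_simp
  ring
end

section
/- Let n ≥ 1, γ > 0, f0 > 0, let ψ : [0, ∞) → ℝⁿ and χ : [0, ∞) → ℝ be continuous, and suppose: F : [0, ∞) → (n×n real matrices) is differentiable with F'(t) = −γ·F(t)·ψ(t)·ψ(t)ᵀ·F(t) + χ(t)·F(t) and F(0) = (1/f0)·Iₙ, and F(t) is invertible for every t ≥ 0; e : [0, ∞) → ℝⁿ is differentiable with e'(t) = −γ·F(t)·ψ(t)·ψ(t)ᵀ·e(t); and z : [0, ∞) → ℝ is differentiable with z'(t) = −χ(t)·z(t), z(0) = 1. Then e(t) = f0·z(t)·F(t)·e(0) for all t ≥ 0. -/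
open Matrix

theorem abs_dotProduct_le_sum_abs_mul_norm {ι : Type*} [Fintype ι] (v w : ι → ℝ) :
    |v ⬝ᵥ w| ≤ (∑ i, |v i|) * ‖w‖ := by
  rw [Finset.sum_mul]
  refine (Finset.abs_sum_le_sum_abs _ _).trans (Finset.sum_le_sum fun i _ => ?_)
  rw [abs_mul]
  exact mul_le_mul_of_nonneg_left (norm_le_pi_norm w i) (abs_nonneg _)

/-- A solution of the rank-one linear equation `d' = -γ (ψ ⬝ᵥ d) b` which vanishes at the initial
time vanishes at all later times. -/
theorem eq_zero_of_hasDerivAt_rank_one {ι : Type*} [Fintype ι] {γ : ℝ} {ψ b d : ℝ → ι → ℝ}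
    (hψ : Continuous ψ) (hb : ContinuousOn b (Set.Ici 0)) (hd0 : d 0 = 0)
    (hd : ∀ t ≥ (0 : ℝ), HasDerivAt d ((-γ * (ψ t ⬝ᵥ d t)) • b t) t) :
    ∀ t ≥ (0 : ℝ), d t = 0 := by
  intro T hT
  have hcont : ContinuousOn (fun t => |γ| * (∑ i, |ψ t i|) * ‖b t‖) (Set.Icc 0 T) := by
    have hb' : ContinuousOn b (Set.Icc 0 T) := hb.mono Set.Icc_subset_Ici_self
    have hs : Continuous fun t => |γ| * ∑ i, |ψ t i| := by fun_prop
    exact hs.continuousOn.mul hb'.norm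
  obtain ⟨K, hK⟩ := isCompact_Icc.bddAbove_image hcont
  have hbound : ∀ t ∈ Set.Ico 0 T, ‖(-γ * (ψ t ⬝ᵥ d t)) • b t‖ ≤ K * ‖d t‖ := by
    intro t ht
    have hKt := hK (Set.mem_image_of_mem _ (Set.Ico_subset_Icc_self ht))
    rw [norm_smul, Real.norm_eq_abs, abs_mul, abs_neg]
    calc |γ| * |ψ t ⬝ᵥ d t| * ‖b t‖ ≤ |γ| * ((∑ i, |ψ t i|) * ‖d t‖) * ‖b t‖ := by
          gcongr
          exact abs_dotProduct_le_sum_abs_mul_norm _ _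
      _ = (|γ| * (∑ i, |ψ t i|) * ‖b t‖) * ‖d t‖ := by ring
      _ ≤ K * ‖d t‖ := mul_le_mul_of_nonneg_right hKt (norm_nonneg _)
  exact eq_zero_of_abs_deriv_le_mul_abs_self_of_eq_zero_right
    (fun t ht => (hd t ht.1).continuousAt.continuousWithinAt)
    (fun t ht => (hd t ht.1).hasDerivWithinAt) hd0 hbound T ⟨hT, le_rfl⟩

theorem stmt_12 (n : ℕ) (hn : 1 ≤ n) (γ f0 : ℝ) (hγ : 0 < γ) (hf0 : 0 < f0)
    (ψ : ℝ → Fin n → ℝ) (χ : ℝ → ℝ) (hψ : Continuous ψ) (hχ : Continuous χ)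
    (F : ℝ → Matrix (Fin n) (Fin n) ℝ)
    (hF : ∀ t ≥ (0:ℝ), ∀ i j, HasDerivAt (fun τ => F τ i j)
      (((-γ) • (F t * Matrix.vecMulVec (ψ t) (ψ t) * F t) + χ t • F t) i j) t)
    (hF0 : F 0 = (1 / f0) • (1 : Matrix (Fin n) (Fin n) ℝ))
    (hFinv : ∀ t ≥ (0:ℝ), IsUnit (F t))
    (e : ℝ → Fin n → ℝ)
    (he : ∀ t ≥ (0:ℝ), HasDerivAt e ((-γ * (ψ t ⬝ᵥ e t)) • (F t).mulVec (ψ t)) t)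
    (z : ℝ → ℝ)
    (hz : ∀ t ≥ (0:ℝ), HasDerivAt z (-χ t * z t) t) (hz0 : z 0 = 1) :
    ∀ t ≥ (0:ℝ), e t = (f0 * z t) • (F t).mulVec (e 0) := by
  have hFc : ContinuousOn F (Set.Ici 0) := continuousOn_pi.2 fun i => continuousOn_pi.2 fun j =>
    fun t ht => (hF t ht i j).continuousAt.continuousWithinAt
  have hb : ContinuousOn (fun t => (F t).mulVec (ψ t)) (Set.Ici 0) :=
    (continuous_fst.matrix_mulVec continuous_snd).comp_continuousOn
      (hFc.prodMk hψ.continuousOn)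
  have hw : ∀ t ≥ (0 : ℝ), HasDerivAt (fun τ => (f0 * z τ) • (F τ).mulVec (e 0))
      ((-γ * (ψ t ⬝ᵥ ((f0 * z t) • (F t).mulVec (e 0)))) • (F t).mulVec (ψ t)) t := by
    intro t ht
    refine hasDerivAt_pi.2 fun i => ?_
    have hFe : HasDerivAt (fun τ => (F τ).mulVec (e 0) i)
        ((((-γ) • (F t * Matrix.vecMulVec (ψ t) (ψ t) * F t) + χ t • F t).mulVec (e 0)) i) t :=
      HasDerivAt.fun_sum (u := Finset.univ) fun j _ => (hF t ht i j).mul_const (e 0 j)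
    refine (((hz t ht).const_mul f0).mul hFe).congr_deriv ?_
    simp only [Matrix.add_mulVec, Matrix.smul_mulVec, ← Matrix.mulVec_mulVec,
      Matrix.vecMulVec_mulVec, Matrix.mulVec_smul, dotProduct_smul, Pi.add_apply,
      Pi.smul_apply, smul_eq_mul, op_smul_eq_smul]
    ring
  have hd := eq_zero_of_hasDerivAt_rank_one (γ := γ)
    (d := fun t => e t - (f0 * z t) • (F t).mulVec (e 0)) hψ hb
    (by simp [hz0, hF0, Matrix.smul_mulVec, smul_smul, hf0.ne'])
    (fun t ht => ((he t ht).sub (hw t ht)).congr_deriv (by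
      rw [dotProduct_sub, mul_sub, sub_smul]))
  exact fun t ht => sub_eq_zero.1 (hd t ht)
end

section
/- Let n ≥ 1, γ > 0, f0 > 0, let ψ : [0, ∞) → ℝⁿ and χ : [0, ∞) → ℝ be continuous, let G ∈ ℝⁿ be constant, and suppose: F : [0, ∞) → (n×n real matrices) is differentiable with F'(t) = −γ·F(t)·ψ(t)·ψ(t)ᵀ·F(t) + χ(t)·F(t), F(0) = (1/f0)·Iₙ, and F(t) invertible for every t ≥ 0; Ĝ : [0, ∞) → ℝⁿ is differentiable with Ĝ'(t) = γ·F(t)·ψ(t)·(ψ(t)ᵀ·G − ψ(t)ᵀ·Ĝ(t)); and z : [0, ∞) → ℝ is differentiable with z'(t) = −χ(t)·z(t), z(0) = 1. Define Δ(t) := det(Iₙ − z(t)·f0·F(t)) and 𝐘(t) := adj(Iₙ − z(t)·f0·F(t)) · (Ĝ(t) − z(t)·f0·F(t)·Ĝ(0)), where adj denotes the adjugate matrix. Then 𝐘(t) = Δ(t)·G for all t ≥ 0; that is, each component satisfies the scalar linear regression 𝐘ᵢ(t) = Δ(t)·Gᵢ. -/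
open Matrix

/-- A solution of the rank-one linear ODE `w' = -(u ⬝ᵥ w) • v` vanishing at `0` vanishes on
`[0, ∞)`. -/
theorem eq_zero_of_hasDerivAt_neg_dotProduct_smul {ι : Type*} [Fintype ι] {u v w : ℝ → ι → ℝ}
    (hu : ContinuousOn u (Set.Ici 0)) (hv : ContinuousOn v (Set.Ici 0))
    (hw : ∀ t ≥ (0 : ℝ), HasDerivAt w (-(u t ⬝ᵥ w t) • v t) t) (hw0 : w 0 = 0)
    {T : ℝ} (hT : 0 ≤ T) : w T = 0 := by
  have hbdd : BddAbove ((fun t => (∑ i, |u t i|) * ‖v t‖) '' Set.Icc 0 T) := by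
    refine isCompact_Icc.bddAbove_image (ContinuousOn.mono ?_ Set.Icc_subset_Ici_self)
    exact (continuousOn_finsetSum _ fun i _ => (continuousOn_pi.1 hu i).abs).mul hv.norm
  obtain ⟨K, hK⟩ := hbdd
  refine eq_zero_of_abs_deriv_le_mul_abs_self_of_eq_zero_right (K := K)
    (fun t ht => (hw t ht.1).continuousAt.continuousWithinAt)
    (fun t ht => (hw t ht.1).hasDerivWithinAt) hw0 (fun t ht => ?_) T ⟨hT, le_rfl⟩
  have hdot : |u t ⬝ᵥ w t| ≤ (∑ i, |u t i|) * ‖w t‖ := by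
    rw [dotProduct, Finset.sum_mul]
    refine (Finset.abs_sum_le_sum_abs _ _).trans (Finset.sum_le_sum fun i _ => ?_)
    rw [abs_mul]
    exact mul_le_mul_of_nonneg_left (norm_le_pi_norm (w t) i) (abs_nonneg _)
  calc ‖-(u t ⬝ᵥ w t) • v t‖ = |u t ⬝ᵥ w t| * ‖v t‖ := by
        rw [norm_smul, Real.norm_eq_abs, abs_neg]
    _ ≤ (∑ i, |u t i|) * ‖w t‖ * ‖v t‖ := by gcongr
    _ = (∑ i, |u t i|) * ‖v t‖ * ‖w t‖ := by ring
    _ ≤ K * ‖w t‖ := by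
        gcongr
        exact hK ⟨t, ⟨ht.1, ht.2.le⟩, rfl⟩

theorem stmt_13 (n : ℕ) (hn : 1 ≤ n) (γ f0 : ℝ) (hγ : 0 < γ) (hf0 : 0 < f0)
    (ψ : ℝ → Fin n → ℝ) (χ : ℝ → ℝ) (hψ : Continuous ψ) (hχ : Continuous χ)
    (G : Fin n → ℝ)
    (F : ℝ → Matrix (Fin n) (Fin n) ℝ)
    (hF : ∀ t ≥ (0:ℝ), ∀ i j, HasDerivAt (fun τ => F τ i j)
      (((-γ) • (F t * Matrix.vecMulVec (ψ t) (ψ t) * F t) + χ t • F t) i j) t)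
    (hF0 : F 0 = (1 / f0) • (1 : Matrix (Fin n) (Fin n) ℝ))
    (hFinv : ∀ t ≥ (0:ℝ), IsUnit (F t))
    (Ghat : ℝ → Fin n → ℝ)
    (hGhat : ∀ t ≥ (0:ℝ), HasDerivAt Ghat
      ((γ * (ψ t ⬝ᵥ G - ψ t ⬝ᵥ Ghat t)) • (F t).mulVec (ψ t)) t)
    (z : ℝ → ℝ)
    (hz : ∀ t ≥ (0:ℝ), HasDerivAt z (-χ t * z t) t) (hz0 : z 0 = 1)
    (Δ : ℝ → ℝ) (Y : ℝ → Fin n → ℝ)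
    (hΔ : ∀ t, Δ t = Matrix.det (1 - (z t * f0) • F t))
    (hY : ∀ t, Y t = (Matrix.adjugate (1 - (z t * f0) • F t)).mulVec
      (Ghat t - (z t * f0) • (F t).mulVec (Ghat 0))) :
    ∀ t ≥ (0:ℝ), Y t = Δ t • G := by
  have hFcont : ContinuousOn F (Set.Ici 0) :=
    continuousOn_pi.2 fun i => continuousOn_pi.2 fun j t ht =>
      (hF t ht i j).continuousAt.continuousWithinAt
  have hFψ : ContinuousOn (fun t => F t *ᵥ ψ t) (Set.Ici 0) := by
    refine continuousOn_pi.2 fun i => ?_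
    simp only [mulVec, dotProduct]
    refine continuousOn_finsetSum _ fun j _ => ?_
    exact (continuousOn_pi.1 (continuousOn_pi.1 hFcont i) j).mul
      ((continuous_apply j).comp hψ).continuousOn
  have hFe (e : Fin n → ℝ) {t : ℝ} (ht : 0 ≤ t) : HasDerivAt (fun τ => F τ *ᵥ e)
      (((-γ) • (F t * vecMulVec (ψ t) (ψ t) * F t) + χ t • F t) *ᵥ e) t := by
    refine hasDerivAt_pi.2 fun i => ?_
    simp only [mulVec, dotProduct]
    exact HasDerivAt.fun_sum fun j _ => (hF t ht i j).mul_const (e j)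
  have herr {t : ℝ} (ht : 0 ≤ t) :
      Ghat t - G - (z t * f0) • F t *ᵥ (Ghat 0 - G) = 0 := by
    refine eq_zero_of_hasDerivAt_neg_dotProduct_smul
      (w := fun t => Ghat t - G - (z t * f0) • F t *ᵥ (Ghat 0 - G))
      (u := fun t => γ • ψ t) (v := fun t => F t *ᵥ ψ t)
      (hψ.const_smul γ).continuousOn hFψ (fun t ht => ?_) ?_ ht
    · refine (((hGhat t ht).sub_const G).sub
        (((hz t ht).mul_const f0).smul (hFe (Ghat 0 - G) ht))).congr_deriv ?_
      ext i
      simp only [add_mulVec, smul_mulVec, ← mulVec_mulVec, vecMulVec_mulVec, mulVec_smul,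
        dotProduct_sub, dotProduct_smul, smul_dotProduct, Pi.sub_apply, Pi.add_apply,
        Pi.smul_apply, smul_eq_mul, op_smul_eq_smul]
      ring
    · simp [hz0, hF0, smul_mulVec, smul_smul, hf0.ne']
  intro t ht
  have hreg : Ghat t - (z t * f0) • F t *ᵥ Ghat 0 = (1 - (z t * f0) • F t) *ᵥ G := by
    have h := herr ht
    rw [mulVec_sub, smul_sub] at h
    rw [sub_mulVec, one_mulVec, smul_mulVec, ← sub_eq_zero, ← h]
    abel
  rw [hY, hΔ, hreg, mulVec_mulVec, adjugate_mul, smul_mulVec, one_mulVec]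
end

section
/- Let tc > 0 and let ψ : [0, tc] → ℝ³ be continuous. Then the following are equivalent: (i) there exists δ > 0 such that ∫₀^{tc} ψ(s)·ψ(s)ᵀ ds − δ·I₃ is positive semidefinite (i.e. the Gram matrix ∫₀^{tc} ψψᵀ is positive definite); (ii) there exist times t1, t2, t3 ∈ [0, tc] such that the vectors ψ(t1), ψ(t2), ψ(t3) are linearly independent. -/
open Matrix

theorem Matrix.exists_pos_sub_smul_one_posSemidef_iff {n : Type*} [Fintype n] [DecidableEq n]
    [Nonempty n] {A : Matrix n n ℝ} (hA : A.IsHermitian) :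
    (∃ δ > (0 : ℝ), (A - δ • (1 : Matrix n n ℝ)).PosSemidef) ↔ A.PosDef := by
  open scoped MatrixOrder in
  have h := CFC.exists_pos_algebraMap_le_iff (a := A) hA
  simp only [Algebra.algebraMap_eq_smul_one, Matrix.le_iff] at h
  rw [h, ← StarOrderedRing.isStrictlyPositive_iff_spectrum_pos (R := ℝ) A hA,
    isStrictlyPositive_iff_posDef]

section Gram

variable {n : Type*} [Fintype n] {a b : ℝ} {ψ : ℝ → n → ℝ}

theorem dotProduct_intervalGram_mulVec (hab : a ≤ b) (hψ : ContinuousOn ψ (Set.Icc a b))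
    (x : n → ℝ) :
    x ⬝ᵥ (Matrix.of (fun i j => ∫ s in a..b, ψ s i * ψ s j) *ᵥ x) =
      ∫ s in a..b, (x ⬝ᵥ ψ s) ^ 2 := by
  have hc (i : n) : ContinuousOn (fun s => ψ s i) (Set.uIcc a b) := by
    rw [Set.uIcc_of_le hab]
    exact continuousOn_pi.1 hψ i
  have hij (i j : n) : IntervalIntegrable (fun s => x i * (ψ s i * ψ s j * x j))
      MeasureTheory.volume a b :=
    (continuousOn_const.mul (((hc i).mul (hc j)).mul continuousOn_const)).intervalIntegrable
  have hsq (s : ℝ) : (x ⬝ᵥ ψ s) ^ 2 = ∑ i, ∑ j, x i * (ψ s i * ψ s j * x j) := by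
    rw [sq, dotProduct, Finset.sum_mul_sum]
    exact Finset.sum_congr rfl fun i _ => Finset.sum_congr rfl fun j _ => by ring
  simp_rw [hsq]
  rw [intervalIntegral.integral_finsetSum
    fun i _ => by
      simpa only [Finset.sum_fn] using IntervalIntegrable.sum Finset.univ fun j _ => hij i j]
  refine Finset.sum_congr rfl fun i _ => ?_
  rw [intervalIntegral.integral_finsetSum fun j _ => hij i j, mulVec, dotProduct, Finset.mul_sum]
  simp

theorem intervalGram_posDef_iff (hab : a < b) (hψ : ContinuousOn ψ (Set.Icc a b)) :
    (Matrix.of (fun i j => ∫ s in a..b, ψ s i * ψ s j)).PosDef ↔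
      ∀ x : n → ℝ, x ≠ 0 → ∃ t ∈ Set.Icc a b, x ⬝ᵥ ψ t ≠ 0 := by
  simp only [posDef_iff_dotProduct_mulVec, star_trivial,
    dotProduct_intervalGram_mulVec hab.le hψ]
  constructor
  · rintro ⟨-, h⟩ x hx
    by_contra! h0
    refine (h hx).ne' ?_
    rw [intervalIntegral.integral_congr (g := fun _ => 0) fun s hs => ?_]
    · simp
    · rw [Set.uIcc_of_le hab.le] at hs
      simp [h0 s hs]
  · refine fun h => ⟨Matrix.ext fun i j => by simp [mul_comm], fun {x} hx => ?_⟩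
    obtain ⟨t, ht, hxt⟩ := h x hx
    refine intervalIntegral.integral_pos hab (ContinuousOn.pow ?_ 2) (fun _ _ => sq_nonneg _)
      ⟨t, ht, by positivity⟩
    exact continuousOn_finsetSum _ fun i _ => continuousOn_const.mul (continuousOn_pi.1 hψ i)

end Gram

theorem span_eq_top_iff_forall_exists_dotProduct_ne_zero {K n : Type*} [Field K] [Fintype n]
    {s : Set (n → K)} :
    Submodule.span K s = ⊤ ↔ ∀ x : n → K, x ≠ 0 → ∃ v ∈ s, x ⬝ᵥ v ≠ 0 := by
  classical
  constructor
  · intro hs x hx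
    by_contra! h0
    refine hx ((dotProductEquiv K n).map_eq_zero_iff.1 (LinearMap.ext_on hs fun v hv => ?_))
    simpa using h0 v hv
  · intro h
    by_contra hs
    obtain ⟨f, hf, hsf⟩ := Submodule.exists_le_ker_of_lt_top _ (lt_top_iff_ne_top.2 hs)
    obtain ⟨x, rfl⟩ := (dotProductEquiv K n).surjective f
    obtain ⟨v, hv, hxv⟩ := h x fun hx => hf (by simp [hx])
    exact hxv (by simpa using hsf (Submodule.subset_span hv))

theorem span_eq_top_iff_exists_linearIndependent {K V : Type*} [Field K] [AddCommGroup V]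
    [Module K V] [FiniteDimensional K V] {s : Set V} {d : ℕ} (hd : Module.finrank K V = d) :
    Submodule.span K s = ⊤ ↔ ∃ f : Fin d → V, (∀ i, f i ∈ s) ∧ LinearIndependent K f := by
  constructor
  · intro hs
    obtain ⟨f, hfs, -, hf⟩ := Submodule.exists_fun_fin_finrank_span_eq K s
    have hds : d = Module.finrank K (Submodule.span K s) := by rw [hs, finrank_top, hd]
    exact ⟨f ∘ Fin.cast hds, fun i => hfs _, hf.comp _ (Fin.cast_injective hds)⟩
  · rintro ⟨f, hfs, hf⟩
    rw [eq_top_iff, ← hf.span_eq_top_of_card_eq_finrank' (by simp [hd])]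
    exact Submodule.span_mono (Set.range_subset_iff.2 hfs)

theorem stmt_14 (tc : ℝ) (htc : 0 < tc) (ψ : ℝ → Fin 3 → ℝ)
    (hψ : ContinuousOn ψ (Set.Icc 0 tc)) :
    (∃ δ > (0:ℝ),
      (Matrix.of (fun i j => ∫ s in (0:ℝ)..tc, ψ s i * ψ s j)
        - δ • (1 : Matrix (Fin 3) (Fin 3) ℝ)).PosSemidef) ↔
    (∃ t1 ∈ Set.Icc (0:ℝ) tc, ∃ t2 ∈ Set.Icc (0:ℝ) tc, ∃ t3 ∈ Set.Icc (0:ℝ) tc,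
      LinearIndependent ℝ ![ψ t1, ψ t2, ψ t3]) := by
  rw [Matrix.exists_pos_sub_smul_one_posSemidef_iff (Matrix.ext fun i j => by simp [mul_comm]),
    intervalGram_posDef_iff htc hψ]
  have h := (span_eq_top_iff_forall_exists_dotProduct_ne_zero (s := ψ '' Set.Icc 0 tc)).symm.trans
    (span_eq_top_iff_exists_linearIndependent (Module.finrank_fin_fun ℝ))
  simp only [Set.exists_mem_image] at h
  rw [h]
  constructor
  · rintro ⟨f, hfs, hf⟩
    choose t ht htf using hfs
    refine ⟨t 0, ht 0, t 1, ht 1, t 2, ht 2, ?_⟩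
    have hfψ : ![ψ (t 0), ψ (t 1), ψ (t 2)] = f := by
      ext i : 1
      fin_cases i <;> simp [htf]
    rwa [hfψ]
  · rintro ⟨t1, h1, t2, h2, t3, h3, hli⟩
    refine ⟨_, fun i => ?_, hli⟩
    fin_cases i
    exacts [⟨t1, h1, rfl⟩, ⟨t2, h2, rfl⟩, ⟨t3, h3, rfl⟩]
end
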